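/- Let n ≥ 1, Ω ⊆ ℝⁿ open, m_S > 0, α₁ > 0, α₂ ∈ ℝ; set α̂₁ := α₁/(m_S²α₁² + α₂²), α̂₂ := α₂/(m_S²α₁² + α₂²). Let h : ℝ × Ω → ℝ³ and let m : ℝ × Ω → ℝ³ be differentiable in time and twice continuously differentiable in space with ‖m(t,x)‖ = m_S for all (t,x). If m satisfies α̂₁ m_S² m_t − α̂₂ m × m_t − m_S² Δm = |∇m|² m + m_S² h − ⟨m, h⟩ m pointwise on ℝ × Ω, then m satisfies the Landau-Lifshitz-Gilbert equation m_t = −α₁ m × (m × (Δm + h)) + α₂ m × (Δm + h) pointwise on ℝ × Ω. -/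

import Mathlib

/-- The cross product on three-dimensional Euclidean space `ℝ³ = EuclideanSpace ℝ (Fin 3)`. -/
noncomputable def cross3 (a b : EuclideanSpace ℝ (Fin 3)) : EuclideanSpace ℝ (Fin 3) :=
  !₂[a 1 * b 2 - a 2 * b 1, a 2 * b 0 - a 0 * b 2, a 0 * b 1 - a 1 * b 0]

/-- The `j`-th partial derivative of a vector field `u : ℝⁿ → ℝ³`. -/
noncomputable def pderiv3 {n : ℕ} (u : EuclideanSpace ℝ (Fin n) → EuclideanSpace ℝ (Fin 3))
    (j : Fin n) (x : EuclideanSpace ℝ (Fin n)) : EuclideanSpace ℝ (Fin 3) :=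
  fderiv ℝ u x (EuclideanSpace.single j 1)

/-- The componentwise Laplacian `Δu = Σ_j ∂²u/∂x_j²` of a vector field `u : ℝⁿ → ℝ³`. -/
noncomputable def laplacian3 {n : ℕ} (u : EuclideanSpace ℝ (Fin n) → EuclideanSpace ℝ (Fin 3))
    (x : EuclideanSpace ℝ (Fin n)) : EuclideanSpace ℝ (Fin 3) :=
  ∑ j : Fin n, pderiv3 (fun y => pderiv3 u j y) j x

lemma cross3_add (a b c : EuclideanSpace ℝ (Fin 3)) :
    cross3 a (b + c) = cross3 a b + cross3 a c := by
  ext i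
  fin_cases i <;> simp [cross3] <;> ring

lemma cross3_sub (a b c : EuclideanSpace ℝ (Fin 3)) :
    cross3 a (b - c) = cross3 a b - cross3 a c := by
  ext i
  fin_cases i <;> simp [cross3] <;> ring

lemma cross3_smul (r : ℝ) (a b : EuclideanSpace ℝ (Fin 3)) :
    cross3 a (r • b) = r • cross3 a b := by
  ext i
  fin_cases i <;> simp [cross3] <;> ring

lemma cross3_self (a : EuclideanSpace ℝ (Fin 3)) : cross3 a a = 0 := by
  ext i
  fin_cases i <;> simp [cross3] <;> ring

lemma cross3_cross3_self_left (a b : EuclideanSpace ℝ (Fin 3)) :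
    cross3 a (cross3 a b) = (inner ℝ a b : ℝ) • a - (‖a‖ ^ 2) • b := by
  rw [EuclideanSpace.real_norm_sq_eq]
  ext i
  fin_cases i <;> simp [cross3, PiLp.inner_apply, Fin.sum_univ_three] <;> ring

lemma inner_deriv_eq_zero_of_norm_eq {E : Type*} [NormedAddCommGroup E] [InnerProductSpace ℝ E]
    {u : ℝ → E} {r t : ℝ} (hu : DifferentiableAt ℝ u t) (hr : ∀ s, ‖u s‖ = r) :
    inner ℝ (u t) (deriv u t) = (0 : ℝ) := by
  have hd := hu.hasDerivAt.norm_sq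
  simp only [hr] at hd
  have := hd.unique (hasDerivAt_const t (r ^ 2))
  linarith

/-- If `H` is, up to a multiple of `a`, the image of `v ⟂ a` under
`v ↦ α̂₁ ‖a‖² v - α̂₂ a × v`, then `v` is recovered from `H` by the Landau-Lifshitz-Gilbert
right-hand side. -/
lemma eq_llg_of_smul_sub_cross3_eq {a v H : EuclideanSpace ℝ (Fin 3)} {r α₁ α₂ c : ℝ}
    (hr : 0 < r) (hα₁ : 0 < α₁) (ha : ‖a‖ = r) (hav : inner ℝ a v = (0 : ℝ))
    (hH : (r ^ 2) • H = (α₁ / (r ^ 2 * α₁ ^ 2 + α₂ ^ 2) * r ^ 2) • v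
      - (α₂ / (r ^ 2 * α₁ ^ 2 + α₂ ^ 2)) • cross3 a v - c • a) :
    v = -α₁ • cross3 a (cross3 a H) + α₂ • cross3 a H := by
  have hD : r ^ 2 * α₁ ^ 2 + α₂ ^ 2 ≠ 0 := by positivity
  have hr2 : r ^ 2 ≠ 0 := by positivity
  have haav : cross3 a (cross3 a v) = -(r ^ 2) • v := by
    rw [cross3_cross3_self_left, hav, ha]
    module
  have haH : cross3 a H = (α₁ / (r ^ 2 * α₁ ^ 2 + α₂ ^ 2)) • cross3 a v
      + (α₂ / (r ^ 2 * α₁ ^ 2 + α₂ ^ 2)) • v := by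
    apply smul_right_injective _ hr2
    change r ^ 2 • cross3 a H = r ^ 2 • _
    rw [← cross3_smul, hH, cross3_sub, cross3_sub, cross3_smul, cross3_smul, cross3_smul,
      cross3_self, haav]
    module
  rw [haH, cross3_add, cross3_smul, cross3_smul, haav]
  match_scalars
  · field_simp
  · ring

/-- If a magnetization `m` of constant modulus `m_S` satisfies the reformulated equation
`αhat₁ m_S² m_t − αhat₂ m × m_t − m_S² Δm = |∇m|² m + m_S² h − ⟨m, h⟩ m` on `ℝ × Ω`, where
`αhat₁ := α₁/(m_S²α₁² + α₂²)`, `αhat₂ := α₂/(m_S²α₁² + α₂²)` with `α₁ > 0`, then it satisfies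
the Landau-Lifshitz-Gilbert equation
`m_t = −α₁ m × (m × (Δm + h)) + α₂ m × (Δm + h)` on `ℝ × Ω`. -/
theorem reformulated_implies_llg (n : ℕ) (hn : 1 ≤ n)
    (Ω : Set (EuclideanSpace ℝ (Fin n))) (hΩ : IsOpen Ω)
    (mS α₁ α₂ : ℝ) (hmS : 0 < mS) (hα₁ : 0 < α₁)
    (αhat₁ αhat₂ : ℝ) (hαhat₁ : αhat₁ = α₁ / (mS ^ 2 * α₁ ^ 2 + α₂ ^ 2))
    (hαhat₂ : αhat₂ = α₂ / (mS ^ 2 * α₁ ^ 2 + α₂ ^ 2))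
    (h : ℝ → EuclideanSpace ℝ (Fin n) → EuclideanSpace ℝ (Fin 3))
    (m : ℝ → EuclideanSpace ℝ (Fin n) → EuclideanSpace ℝ (Fin 3))
    (hmt : ∀ x ∈ Ω, ∀ t : ℝ, DifferentiableAt ℝ (fun s => m s x) t)
    (hmx : ∀ t : ℝ, ContDiffOn ℝ 2 (m t) Ω)
    (hmod : ∀ t : ℝ, ∀ x ∈ Ω, ‖m t x‖ = mS)
    (href : ∀ t : ℝ, ∀ x ∈ Ω,
      (αhat₁ * mS ^ 2) • deriv (fun s => m s x) t
          - αhat₂ • cross3 (m t x) (deriv (fun s => m s x) t)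
          - (mS ^ 2) • laplacian3 (m t) x
        = (∑ j : Fin n, ‖pderiv3 (m t) j x‖ ^ 2) • m t x + (mS ^ 2) • h t x
          - (inner ℝ (m t x) (h t x) : ℝ) • m t x) :
    ∀ t : ℝ, ∀ x ∈ Ω,
      deriv (fun s => m s x) t
        = -α₁ • cross3 (m t x) (cross3 (m t x) (laplacian3 (m t) x + h t x))
          + α₂ • cross3 (m t x) (laplacian3 (m t) x + h t x) := by
  intro t x hx
  subst hαhat₁ hαhat₂
  refine eq_llg_of_smul_sub_cross3_eq
    (c := (∑ j : Fin n, ‖pderiv3 (m t) j x‖ ^ 2) - inner ℝ (m t x) (h t x)) hmS hα₁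
    (hmod t x hx) (inner_deriv_eq_zero_of_norm_eq (hmt x hx t) fun s => hmod s x hx) ?_
  linear_combination (norm := module) (-1 : ℝ) • href t x hx
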